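/- In the sliced setting, let p ≥ 1 and let H = L^p([0,1] × V, Leb ⊗ λ). Define Φ : 𝒫_p(E) → H by Φ(μ)(q, v) = F^{-1}_{P^v_#μ}(q), where F^{-1}_η denotes the quantile function of a probability measure η on ℝ. Then for all μ, ν ∈ 𝒫_p(E), CHSW_p^p(μ, ν) = ‖Φ(μ) − Φ(ν)‖_H^p; in particular CHSW_p is Hilbertian for p = 2. -/

import Mathlib

open MeasureTheory ENNReal

/-- The infimal transport cost between `μ` and `ν` for an `ℝ≥0∞`-valued cost `c`. -/
noncomputable def transportCost {X : Type*} [MeasurableSpace X]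
    (c : X → X → ℝ≥0∞) (μ ν : Measure X) : ℝ≥0∞ :=
  ⨅ γ ∈ {γ : Measure (X × X) | γ.map Prod.fst = μ ∧ γ.map Prod.snd = ν},
    ∫⁻ z, c z.1 z.2 ∂γ

/-- `W_p^p` on the real line, with ground distance `|s - t|`. -/
noncomputable def wpPowReal (p : ℝ) (μ ν : Measure ℝ) : ℝ≥0∞ :=
  transportCost (fun s t => ENNReal.ofReal (|s - t| ^ p)) μ ν

/-- `CHSW_p^p(μ, ν) = ∫ W_p^p(P^v_#μ, P^v_#ν) dλ(v)`. -/
noncomputable def chswPow {E V : Type*} [MeasurableSpace E] [MeasurableSpace V]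
    (P : V → E → ℝ) (lam : Measure V) (p : ℝ) (μ ν : Measure E) : ℝ≥0∞ :=
  ∫⁻ v, wpPowReal p (μ.map (P v)) (ν.map (P v)) ∂lam

/-- `CHSW_p = (CHSW_p^p)^{1/p}`. -/
noncomputable def chsw {E V : Type*} [MeasurableSpace E] [MeasurableSpace V]
    (P : V → E → ℝ) (lam : Measure V) (p : ℝ) (μ ν : Measure E) : ℝ≥0∞ :=
  (chswPow P lam p μ ν) ^ (1 / p)

/-- The quantile function `F⁻¹_η(q) = inf {t : ℝ | F_η(t) ≥ q}` of a measure `η` on `ℝ`. -/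
noncomputable def quantileFn (η : Measure ℝ) (q : ℝ) : ℝ :=
  sInf {t : ℝ | q ≤ ProbabilityTheory.cdf η t}

open Set Filter Topology ProbabilityTheory in
/-- The Galois connection between the quantile function and the cumulative distribution
function. -/
theorem quantileFn_le_iff (η : Measure ℝ) {q : ℝ} (hq : q ∈ Ioo (0 : ℝ) 1) (t : ℝ) :
    quantileFn η q ≤ t ↔ q ≤ cdf η t := by
  constructor
  · intro h
    have hne : {t : ℝ | q ≤ cdf η t}.Nonempty := by
      obtain ⟨s, hs⟩ := ((tendsto_cdf_atTop η).eventually (lt_mem_nhds hq.2)).exists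
      exact ⟨s, hs.le⟩
    have hright : Tendsto (cdf η) (𝓝[>] t) (𝓝 (cdf η t)) :=
      ((cdf η).right_continuous t).mono Ioi_subset_Ici_self
    refine ge_of_tendsto hright ?_
    filter_upwards [self_mem_nhdsWithin] with s hs
    obtain ⟨r, hr, hrs⟩ := exists_lt_of_csInf_lt hne (lt_of_le_of_lt h hs)
    exact le_trans hr (monotone_cdf η hrs.le)
  · intro h
    obtain ⟨s, hs⟩ := ((tendsto_cdf_atBot η).eventually (gt_mem_nhds hq.1)).exists
    refine csInf_le ⟨s, fun r hr => ?_⟩ h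
    by_contra! hrs
    exact absurd (le_trans hr (monotone_cdf η hrs.le)) (not_le.mpr hs)

open Set in
/-- Quantile functions of a measurable family are jointly measurable on `(0, 1)`. -/
theorem measurable_indicator_quantileFn {V : Type*} [MeasurableSpace V] (κ : V → Measure ℝ)
    [∀ v, IsProbabilityMeasure (κ v)] (hκ : ∀ t, Measurable fun v => κ v (Iic t)) :
    Measurable ((Ioo (0 : ℝ) 1 ×ˢ (univ : Set V)).indicator
      fun z => quantileFn (κ z.2) z.1) := by
  have hS : MeasurableSet (Ioo (0 : ℝ) 1 ×ˢ (univ : Set V)) :=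
    measurableSet_Ioo.prod MeasurableSet.univ
  refine measurable_of_Iic fun t => ?_
  have hcdf : Measurable fun v => ProbabilityTheory.cdf (κ v) t := by
    simp_rw [ProbabilityTheory.cdf_eq_real, measureReal_def]
    exact (hκ t).ennreal_toReal
  have hle : MeasurableSet {z : ℝ × V | z.1 ≤ ProbabilityTheory.cdf (κ z.2) t} :=
    measurableSet_le measurable_fst (hcdf.comp measurable_snd)
  have hpre : (Ioo (0 : ℝ) 1 ×ˢ (univ : Set V)).indicator
      (fun z => quantileFn (κ z.2) z.1) ⁻¹' Iic t =
      (Ioo (0 : ℝ) 1 ×ˢ univ) ∩ {z | z.1 ≤ ProbabilityTheory.cdf (κ z.2) t} ∪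
        (Ioo (0 : ℝ) 1 ×ˢ univ)ᶜ ∩ {_z | 0 ≤ t} := by
    ext z
    by_cases hz : z ∈ Ioo (0 : ℝ) 1 ×ˢ (univ : Set V)
    · simp only [mem_preimage, indicator_of_mem hz, mem_Iic, mem_union, mem_inter_iff, hz,
        mem_compl_iff, mem_ofPred_eq, true_and, not_true, false_and, or_false]
      exact quantileFn_le_iff _ hz.1 t
    · simp only [mem_preimage, indicator_of_notMem hz, mem_Iic, mem_union, mem_inter_iff, hz,
        mem_compl_iff, mem_ofPred_eq, true_and, not_false_eq_true, false_and, false_or]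
  rw [hpre]
  exact (hS.inter hle).union (hS.compl.inter (MeasurableSet.const _))

open Set in
theorem aemeasurable_quantileFn (η : Measure ℝ) [IsProbabilityMeasure η] :
    AEMeasurable (quantileFn η) (volume.restrict (Ioo (0 : ℝ) 1)) := by
  have h := (measurable_indicator_quantileFn (fun _ : Unit => η) fun _ => measurable_const).comp
    (measurable_id.prodMk measurable_const : Measurable fun q : ℝ => (q, ()))
  refine ⟨_, h, ?_⟩
  filter_upwards [ae_restrict_mem measurableSet_Ioo] with q hq
  simp only [Function.comp_apply]
  have hmem : ((id q, ()) : ℝ × Unit) ∈ Ioo (0 : ℝ) 1 ×ˢ univ := ⟨hq, mem_univ _⟩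
  rw [indicator_of_mem hmem, id]

open Set in
/-- The quantile function pushes the uniform law on `(0, 1)` forward to `η`. -/
theorem map_quantileFn (η : Measure ℝ) [IsProbabilityMeasure η] :
    (volume.restrict (Ioo (0 : ℝ) 1)).map (quantileFn η) = η := by
  refine Measure.ext_of_Iic _ _ fun t => ?_
  rw [Measure.map_apply_of_aemeasurable (aemeasurable_quantileFn η) measurableSet_Iic,
    ← ProbabilityTheory.ofReal_cdf]
  have hae : (quantileFn η ⁻¹' Iic t : Set ℝ) =ᵐ[volume.restrict (Ioo (0 : ℝ) 1)]
      Iic (ProbabilityTheory.cdf η t) := by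
    rw [Filter.eventuallyEq_set]
    filter_upwards [ae_restrict_mem measurableSet_Ioo] with q hq
    exact quantileFn_le_iff η hq t
  rw [measure_congr hae, restrict_Ioo_eq_restrict_Ioc, Measure.restrict_apply measurableSet_Iic,
    inter_comm, Ioc_inter_Iic, Real.volume_Ioc,
    min_eq_right (ProbabilityTheory.cdf_le_one η t), sub_zero]

open Set in
/-- A power of the positive part is a mixture of the hinge functions `x ↦ (x - c)⁺`. -/
theorem exists_measure_rpow_eq_lintegral_sub {p : ℝ} (hp : 1 ≤ p) :
    ∃ ρ : Measure ℝ, SFinite ρ ∧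
      ∀ x : ℝ, ENNReal.ofReal x ^ p = ∫⁻ c, ENNReal.ofReal (x - c) ∂ρ := by
  rcases hp.eq_or_lt with rfl | hp
  · exact ⟨Measure.dirac 0, inferInstance, fun x => by
      rw [lintegral_dirac' _ (by fun_prop), ENNReal.rpow_one, sub_zero]⟩
  let w : ℝ → ℝ := fun c => p * (p - 1) * c ^ (p - 2)
  have hw : Measurable fun c => ENNReal.ofReal (w c) := by fun_prop
  refine ⟨(volume.restrict (Ioi 0)).withDensity fun c => ENNReal.ofReal (w c),
    inferInstance, fun x => ?_⟩
  rw [lintegral_withDensity_eq_lintegral_mul _ hw (by fun_prop)]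
  simp only [Pi.mul_apply]
  rcases le_or_gt x 0 with hx | hx
  · rw [ENNReal.ofReal_of_nonpos hx, ENNReal.zero_rpow_of_pos (by linarith)]
    symm
    rw [lintegral_eq_zero_iff (by fun_prop)]
    filter_upwards [ae_restrict_mem measurableSet_Ioi] with c hc
    simp [ENNReal.ofReal_of_nonpos (show x - c ≤ 0 by linarith [mem_Ioi.mp hc])]
  have hi : ∀ r : ℝ, -1 < r → IntervalIntegrable (fun c : ℝ => c ^ r) volume 0 x :=
    fun r hr => intervalIntegral.intervalIntegrable_rpow' hr
  let f : ℝ → ℝ := fun c => p * (p - 1) * (x * c ^ (p - 2) - c ^ (p - 1))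
  have hf : IntervalIntegrable f volume 0 x :=
    (((hi _ (by linarith)).const_mul x).sub (hi _ (by linarith))).const_mul _
  have hfw : ∀ c, 0 < c → f c = w c * (x - c) := by
    intro c hc
    have h : c ^ (p - 1) = c ^ (p - 2) * c := by
      rw [← Real.rpow_add_one hc.ne']; congr 1; ring
    simp only [f, w, h]; ring
  have hw0 : ∀ c, 0 < c → 0 ≤ w c := fun c hc =>
    mul_nonneg (mul_nonneg (by linarith) (by linarith)) (Real.rpow_nonneg hc.le _)
  have hint : ∫ c in (0 : ℝ)..x, f c = x ^ p := by
    simp only [f]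
    rw [intervalIntegral.integral_const_mul, intervalIntegral.integral_sub
      ((hi _ (by linarith)).const_mul x) (hi _ (by linarith)),
      intervalIntegral.integral_const_mul, integral_rpow (Or.inl (by linarith)),
      integral_rpow (Or.inl (by linarith)), Real.zero_rpow (by linarith),
      Real.zero_rpow (by linarith), show p - 2 + 1 = p - 1 by ring,
      show p - 1 + 1 = p by ring, show x ^ p = x ^ (p - 1) * x by
        rw [← Real.rpow_add_one hx.ne']; congr 1; ring]
    have h1 : p - 1 ≠ 0 := by linarith
    have h2 : p ≠ 0 := by linarith
    field_simp
    ring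
  calc ENNReal.ofReal x ^ p = ENNReal.ofReal (∫ c in Ioc 0 x, f c) := by
        rw [← intervalIntegral.integral_of_le hx.le, hint,
          ENNReal.ofReal_rpow_of_pos hx]
    _ = ∫⁻ c in Ioc 0 x, ENNReal.ofReal (f c) := by
        refine ofReal_integral_eq_lintegral_ofReal hf.1 ?_
        filter_upwards [ae_restrict_mem measurableSet_Ioc] with c hc
        rw [hfw c hc.1]
        exact mul_nonneg (hw0 c hc.1) (by linarith [hc.2])
    _ = ∫⁻ c in Ioc 0 x, ENNReal.ofReal (w c) * ENNReal.ofReal (x - c) := by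
        refine setLIntegral_congr_fun measurableSet_Ioc fun c hc => ?_
        simp only [hfw c hc.1, ENNReal.ofReal_mul (hw0 c hc.1)]
    _ = ∫⁻ c in Ioi 0, ENNReal.ofReal (w c) * ENNReal.ofReal (x - c) := by
        have hzero : ∫⁻ c in Ioi x, ENNReal.ofReal (w c) * ENNReal.ofReal (x - c) = 0 := by
          rw [← lintegral_zero (μ := volume.restrict (Ioi x))]
          refine setLIntegral_congr_fun measurableSet_Ioi fun c hc => ?_
          simp [ENNReal.ofReal_of_nonpos (show x - c ≤ 0 by linarith [mem_Ioi.mp hc])]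
        rw [← Ioc_union_Ioi_eq_Ioi hx.le, lintegral_union measurableSet_Ioi
          (Ioc_disjoint_Ioi le_rfl), hzero, add_zero]

/-- Integrals of `((t - s)⁺) ^ p` are monotone in the masses of the quadrants
`{s ≤ a, b < t}`. -/
theorem lintegral_rpow_sub_mono {p : ℝ} (hp : 1 ≤ p) (γ γ' : Measure (ℝ × ℝ))
    [SFinite γ] [SFinite γ']
    (h : ∀ a b, γ {z | z.1 ≤ a ∧ b < z.2} ≤ γ' {z | z.1 ≤ a ∧ b < z.2}) :
    ∫⁻ z, ENNReal.ofReal (z.2 - z.1) ^ p ∂γ ≤ ∫⁻ z, ENNReal.ofReal (z.2 - z.1) ^ p ∂γ' := by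
  obtain ⟨ρ, hρ, hx⟩ := exists_measure_rpow_eq_lintegral_sub hp
  let S : Set ((ℝ × ℝ) × (ℝ × ℝ)) := {y | y.1.1 ≤ y.2.2 ∧ y.2.2 + y.2.1 < y.1.2}
  have hS : MeasurableSet S :=
    (measurableSet_le (f := fun y : (ℝ × ℝ) × (ℝ × ℝ) => y.1.1) (g := fun y => y.2.2)
      (by fun_prop) (by fun_prop)).inter
    (measurableSet_lt (f := fun y : (ℝ × ℝ) × (ℝ × ℝ) => y.2.2 + y.2.1) (g := fun y => y.1.2)
      (by fun_prop) (by fun_prop))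
  have key : ∀ γ : Measure (ℝ × ℝ), SFinite γ → ∫⁻ z, ENNReal.ofReal (z.2 - z.1) ^ p ∂γ =
      ∫⁻ y, γ {z | z.1 ≤ y.2 ∧ y.2 + y.1 < z.2} ∂(ρ.prod volume) := by
    intro γ _
    have h1 := Measure.prod_apply (μ := γ) (ν := ρ.prod volume) hS
    rw [Measure.prod_apply_symm hS] at h1
    refine Eq.trans ?_ h1.symm
    refine lintegral_congr fun z => ?_
    rw [hx, Measure.prod_apply (measurable_prodMk_left hS)]
    refine lintegral_congr fun c => ?_
    have hset : Prod.mk c ⁻¹' (Prod.mk z ⁻¹' S) = Set.Ico z.1 (z.2 - c) := by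
      ext a
      simp only [S, Set.mem_preimage, Set.mem_ofPred_eq, Set.mem_Ico, lt_sub_iff_add_lt]
    rw [hset, Real.volume_Ico]
    congr 1
    ring
  rw [key γ ‹_›, key γ' ‹_›]
  exact lintegral_mono fun y => h _ _

theorem ofReal_abs_sub_rpow {p : ℝ} (hp : 0 < p) (s t : ℝ) :
    ENNReal.ofReal (|s - t| ^ p) =
      ENNReal.ofReal (t - s) ^ p + ENNReal.ofReal (s - t) ^ p := by
  rw [← ENNReal.ofReal_rpow_of_nonneg (abs_nonneg _) hp.le]
  rcases le_total s t with h | h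
  · rw [abs_of_nonpos (by linarith), ENNReal.ofReal_of_nonpos (p := s - t) (by linarith),
      ENNReal.zero_rpow_of_pos hp, add_zero, neg_sub]
  · rw [abs_of_nonneg (by linarith), ENNReal.ofReal_of_nonpos (p := t - s) (by linarith),
      ENNReal.zero_rpow_of_pos hp, zero_add]

open Set in
/-- Among all couplings, the quantile coupling gives the least mass to the quadrants
`{s ≤ a, b < t}`. -/
theorem map_quantileFn_quadrant_le (γ : Measure (ℝ × ℝ))
    [IsProbabilityMeasure (γ.map Prod.fst)] [IsProbabilityMeasure (γ.map Prod.snd)] (a b : ℝ) :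
    (volume.restrict (Ioo (0 : ℝ) 1)).map
        (fun q => (quantileFn (γ.map Prod.fst) q, quantileFn (γ.map Prod.snd) q))
        {z | z.1 ≤ a ∧ b < z.2} ≤ γ {z | z.1 ≤ a ∧ b < z.2} := by
  set η := γ.map Prod.fst
  set θ := γ.map Prod.snd
  have hS : MeasurableSet {z : ℝ × ℝ | z.1 ≤ a ∧ b < z.2} :=
    (measurableSet_le measurable_fst measurable_const).inter
      (measurableSet_lt measurable_const measurable_snd)
  rw [Measure.map_apply_of_aemeasurable
    ((aemeasurable_quantileFn η).prodMk (aemeasurable_quantileFn θ)) hS]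
  calc _ ≤ volume.restrict (Ioo (0 : ℝ) 1)
          (Ioc (ProbabilityTheory.cdf θ b) (ProbabilityTheory.cdf η a)) := by
        refine measure_mono_ae ?_
        filter_upwards [ae_restrict_mem measurableSet_Ioo] with q hq h
        exact ⟨lt_of_not_ge fun h' => not_lt.mpr ((quantileFn_le_iff θ hq b).mpr h') h.2,
          (quantileFn_le_iff η hq a).mp h.1⟩
    _ ≤ ENNReal.ofReal (ProbabilityTheory.cdf η a - ProbabilityTheory.cdf θ b) :=
        (Measure.restrict_apply_le _ _).trans_eq Real.volume_Ioc
    _ = η (Iic a) - θ (Iic b) := by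
        rw [ENNReal.ofReal_sub _ (ProbabilityTheory.cdf_nonneg _ _),
          ProbabilityTheory.ofReal_cdf, ProbabilityTheory.ofReal_cdf]
    _ ≤ _ := by
        rw [tsub_le_iff_right, Measure.map_apply measurable_fst measurableSet_Iic,
          Measure.map_apply measurable_snd measurableSet_Iic]
        refine (measure_mono fun z hz => ?_).trans (measure_union_le _ _)
        by_cases h : b < z.2
        · exact Or.inl ⟨hz, h⟩
        · exact Or.inr (not_lt.mp h)

open Set in
/-- On the real line the quantile coupling is optimal for the cost `|s - t| ^ p`. -/
theorem wpPowReal_eq_lintegral_quantileFn {p : ℝ} (hp : 1 ≤ p) (η θ : Measure ℝ)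
    [IsProbabilityMeasure η] [IsProbabilityMeasure θ] :
    wpPowReal p η θ = ∫⁻ q in Ioo (0 : ℝ) 1,
      ENNReal.ofReal (|quantileFn η q - quantileFn θ q| ^ p) := by
  have hη := aemeasurable_quantileFn η
  have hθ := aemeasurable_quantileFn θ
  apply le_antisymm
  · refine (iInf₂_le ((volume.restrict (Ioo (0 : ℝ) 1)).map
      fun q => (quantileFn η q, quantileFn θ q)) ⟨?_, ?_⟩).trans_eq
        (lintegral_map' (by fun_prop) (hη.prodMk hθ))
    · rw [AEMeasurable.map_map_of_aemeasurable measurable_fst.aemeasurable (hη.prodMk hθ)]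
      exact map_quantileFn η
    · rw [AEMeasurable.map_map_of_aemeasurable measurable_snd.aemeasurable (hη.prodMk hθ)]
      exact map_quantileFn θ
  · refine le_iInf₂ fun γ hγ => ?_
    obtain ⟨rfl, rfl⟩ := hγ
    have hγprob : IsProbabilityMeasure γ :=
      (Measure.isProbabilityMeasure_map_iff measurable_fst.aemeasurable).mp ‹_›
    have hp0 : 0 < p := by linarith
    simp_rw [ofReal_abs_sub_rpow hp0]
    have hm : Measurable fun z : ℝ × ℝ => ENNReal.ofReal (z.2 - z.1) ^ p := by fun_prop
    have half : ∀ γ : Measure (ℝ × ℝ), IsProbabilityMeasure γ →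
        ∫⁻ q in Ioo (0 : ℝ) 1, ENNReal.ofReal
          (quantileFn (γ.map Prod.snd) q - quantileFn (γ.map Prod.fst) q) ^ p
          ≤ ∫⁻ z, ENNReal.ofReal (z.2 - z.1) ^ p ∂γ := by
      intro γ _
      have := Measure.isProbabilityMeasure_map (μ := γ) measurable_fst.aemeasurable
      have := Measure.isProbabilityMeasure_map (μ := γ) measurable_snd.aemeasurable
      exact (lintegral_map' hm.aemeasurable ((aemeasurable_quantileFn (γ.map Prod.fst)).prodMk
        (aemeasurable_quantileFn (γ.map Prod.snd)))).symm.trans_le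
          (lintegral_rpow_sub_mono hp _ _ (map_quantileFn_quadrant_le γ))
    rw [lintegral_add_left' (by fun_prop), lintegral_add_left hm]
    refine add_le_add (half γ hγprob) ?_
    have hswap := half (γ.map Prod.swap)
      (Measure.isProbabilityMeasure_map measurable_swap.aemeasurable)
    rwa [Measure.map_map measurable_fst measurable_swap,
      Measure.map_map measurable_snd measurable_swap, lintegral_map hm measurable_swap] at hswap

/-- In the sliced setting, `CHSW_p^p(μ,ν)` equals the `p`-th power of the
`L^p([0,1] × V, Leb ⊗ λ)` norm of `Φ(μ) - Φ(ν)`, where `Φ(μ)(q,v)` is the quantile function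
of `P^v_#μ` evaluated at `q`; in particular `CHSW_p` is Hilbertian for `p = 2`. -/
theorem chswPow_eq_quantile_lp
    {E V : Type*} [MetricSpace E] [CompleteSpace E] [TopologicalSpace.SeparableSpace E]
    [MeasurableSpace E] [BorelSpace E] [MeasurableSpace V]
    (o : E) (lam : Measure V) [IsProbabilityMeasure lam]
    (P : V → E → ℝ) (hP : Measurable (Function.uncurry P))
    (hLip : ∀ v, LipschitzWith 1 (P v)) (hPo : ∀ v, P v o = 0)
    (p : ℝ) (hp : 1 ≤ p)
    (μ ν : Measure E) [IsProbabilityMeasure μ] [IsProbabilityMeasure ν]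
    (hμ : ∫⁻ x, ENNReal.ofReal (dist x o ^ p) ∂μ < ⊤)
    (hν : ∫⁻ x, ENNReal.ofReal (dist x o ^ p) ∂ν < ⊤) :
    chswPow P lam p μ ν =
      ∫⁻ z : ℝ × V,
        ENNReal.ofReal
          (|quantileFn (μ.map (P z.2)) z.1 - quantileFn (ν.map (P z.2)) z.1| ^ p)
        ∂(((volume : Measure ℝ).restrict (Set.Icc (0 : ℝ) 1)).prod lam) := by
  have hPv : ∀ v, Measurable (P v) := fun v => hP.comp measurable_prodMk_left
  have hprob : ∀ (m : Measure E) [IsProbabilityMeasure m] (v : V),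
      IsProbabilityMeasure (m.map (P v)) :=
    fun m _ v => Measure.isProbabilityMeasure_map (hPv v).aemeasurable
  have hq : ∀ (m : Measure E) [IsProbabilityMeasure m],
      AEMeasurable (fun z : ℝ × V => quantileFn (m.map (P z.2)) z.1)
        ((volume.restrict (Set.Ioo (0 : ℝ) 1)).prod lam) := by
    intro m _
    have := hprob m
    refine ⟨_, measurable_indicator_quantileFn (fun v => m.map (P v)) fun t => ?_, ?_⟩
    · simp_rw [Measure.map_apply (hPv _) measurableSet_Iic]
      exact measurable_measure_prodMk_left (hP measurableSet_Iic)
    · have hmem : ∀ᵐ z ∂((volume.restrict (Set.Ioo (0 : ℝ) 1)).prod lam),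
          z.1 ∈ Set.Ioo (0 : ℝ) 1 :=
        Measure.quasiMeasurePreserving_fst.ae (ae_restrict_mem measurableSet_Ioo)
      filter_upwards [hmem] with z hz
      rw [Set.indicator_of_mem (show z ∈ Set.Ioo (0 : ℝ) 1 ×ˢ Set.univ from ⟨hz, Set.mem_univ _⟩)]
  have hqμ := hq μ
  have hqν := hq ν
  have := hprob μ
  have := hprob ν
  rw [← restrict_Ioo_eq_restrict_Icc, lintegral_prod_symm _ (by fun_prop)]
  exact lintegral_congr fun v => wpPowReal_eq_lintegral_quantileFn hp _ _
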